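/- Let ρ satisfy the moment hypotheses and the decay hypothesis, and let Φ_N be the N-fold convolution of ρ_{h_N}. Then the Fourier transforms of Φ_N converge in L¹: ∫_ℝ |Φ̂_N(y) − exp(−σγ y²/2)| dy → 0 as N → ∞. -/

import Mathlib

open MeasureTheory Filter Real Topology

/-- The Fourier transform `ρ̂(t) = ∫ e^{-itx} ρ(x) dx` of a real-valued function. -/
noncomputable def FT (ρ : ℝ → ℝ) (t : ℝ) : ℂ :=
  ∫ x : ℝ, Complex.exp (-Complex.I * t * x) * (ρ x : ℂ)

/-- `nConv f N` is the `N`-fold convolution `f ∗ ⋯ ∗ f` (`N` factors); junk value `0` for `N = 0`. -/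
noncomputable def nConv (f : ℝ → ℝ) : ℕ → ℝ → ℝ
  | 0 => fun _ => 0
  | 1 => f
  | (n + 2) => fun x => ∫ z : ℝ, nConv f (n + 1) (x - z) * f z

open Convolution

lemma FT_mul_comp_mul (ρ : ℝ → ℝ) {a : ℝ} (ha : 0 < a) (y : ℝ) :
    FT (fun u => a * ρ (a * u)) y = FT ρ (a⁻¹ * y) := by
  have h := Measure.integral_comp_mul_left
    (fun x : ℝ => Complex.exp (-Complex.I * (a⁻¹ * y : ℝ) * x) * (ρ x : ℂ)) a
  rw [abs_of_pos (inv_pos.2 ha)] at h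
  unfold FT
  rw [← one_smul ℝ (∫ x : ℝ, Complex.exp (-Complex.I * (a⁻¹ * y : ℝ) * x) * (ρ x : ℂ)),
    ← mul_inv_cancel₀ ha.ne', mul_smul, ← h, Complex.real_smul, ← integral_const_mul]
  congr with x
  have : (a : ℂ) ≠ 0 := by exact_mod_cast ha.ne'
  have e : -Complex.I * ((a⁻¹ * y : ℝ) : ℂ) * ((a * x : ℝ) : ℂ) = -Complex.I * y * x := by
    push_cast
    field_simp
  rw [e]
  push_cast
  ring

lemma integrable_exp_mul {f : ℝ → ℝ} (hf : Integrable f) (t : ℝ) :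
    Integrable (fun x : ℝ => Complex.exp (-Complex.I * t * x) * (f x : ℂ)) := by
  refine hf.ofReal.bdd_mul (c := 1) (by fun_prop) (ae_of_all _ fun x => ?_)
  rw [Complex.norm_exp]
  simp

lemma FT_convolution {f g : ℝ → ℝ} (hf : Integrable f) (hg : Integrable g) (t : ℝ) :
    FT (f ⋆[ContinuousLinearMap.mul ℝ ℝ] g) t = FT f t * FT g t := by
  have h := integral_convolution (ContinuousLinearMap.mul ℝ ℂ)
    (integrable_exp_mul hf t) (integrable_exp_mul hg t)
  rw [ContinuousLinearMap.mul_apply'] at h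
  unfold FT
  rw [← h]
  congr with x
  simp only [convolution, ContinuousLinearMap.mul_apply']
  rw [← integral_complex_ofReal, ← integral_const_mul]
  congr with z
  have e : Complex.exp (-Complex.I * t * x) =
      Complex.exp (-Complex.I * t * z) * Complex.exp (-Complex.I * t * (x - z : ℝ)) := by
    rw [← Complex.exp_add]
    congr 1
    push_cast
    ring
  rw [e]
  push_cast
  ring

lemma nConv_succ_succ (f : ℝ → ℝ) (n : ℕ) :
    nConv f (n + 2) = f ⋆[ContinuousLinearMap.mul ℝ ℝ] nConv f (n + 1) := by
  ext x
  simp [nConv, convolution, mul_comm]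

lemma integrable_nConv {f : ℝ → ℝ} (hf : Integrable f) (n : ℕ) :
    Integrable (nConv f (n + 1)) := by
  induction n with
  | zero => exact hf
  | succ n ih =>
    rw [nConv_succ_succ]
    exact hf.integrable_convolution _ ih

lemma FT_nConv {f : ℝ → ℝ} (hf : Integrable f) (n : ℕ) (t : ℝ) :
    FT (nConv f (n + 1)) t = FT f t ^ (n + 1) := by
  induction n with
  | zero => simp [nConv]
  | succ n ih => rw [nConv_succ_succ, FT_convolution hf (integrable_nConv hf n), ih]; ring

lemma integral_withDensity_ofReal {E : Type*} [NormedAddCommGroup E] [NormedSpace ℝ E]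
    {ρ : ℝ → ℝ} (hρ : Integrable ρ) (hpos : ∀ᵐ x : ℝ, 0 ≤ ρ x) (g : ℝ → E) :
    ∫ x, g x ∂(volume.withDensity fun x => ENNReal.ofReal (ρ x)) = ∫ x, ρ x • g x := by
  rw [integral_withDensity_eq_integral_toReal_smul₀ hρ.aemeasurable.ennreal_ofReal
    (ae_of_all _ fun _ => ENNReal.ofReal_lt_top)]
  refine integral_congr_ae ?_
  filter_upwards [hpos] with x hx
  rw [ENNReal.toReal_ofReal hx]

lemma FT_eq_charFun {ρ : ℝ → ℝ} (hρ : Integrable ρ) (hpos : ∀ᵐ x : ℝ, 0 ≤ ρ x) (t : ℝ) :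
    FT ρ t = charFun (volume.withDensity fun x => ENNReal.ofReal (ρ x)) (-t) := by
  rw [charFun_apply_real, integral_withDensity_ofReal hρ hpos, FT]
  congr with x
  rw [Complex.real_smul, mul_comm]
  congr 2
  push_cast
  ring

lemma charFun_sub_isLittleO_sq {μ : Measure ℝ} [IsProbabilityMeasure μ]
    (hint : MemLp id 2 μ) (hmean : ∫ x, x ∂μ = 0) :
    (fun t : ℝ => charFun μ t - (1 - (∫ x, x ^ 2 ∂μ : ℝ) * (t : ℂ) ^ 2 / 2)) =o[𝓝 0]
      fun t : ℝ => t ^ 2 := by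
  have h := taylor_isLittleO_univ (x₀ := (0 : ℝ)) (contDiff_charFun (n := 2) hint)
  have e (t : ℝ) := taylorWithinEval_charFun_two_zero (P := μ) (X := id) aemeasurable_id
    (by rwa [Measure.map_id]) t
  simp only [Measure.map_id, id, hmean, Pi.pow_apply] at e
  simp_rw [e] at h
  simpa using h

lemma tendsto_charFun_pow {μ : Measure ℝ} [IsProbabilityMeasure μ]
    (hint : MemLp id 2 μ) (hmean : ∫ x, x ∂μ = 0) (s y : ℝ) (hs : 0 ≤ s) :
    Tendsto (fun N : ℕ => charFun μ (√(s / N) * y) ^ N) atTop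
      (𝓝 (Complex.exp (-s * (∫ x, x ^ 2 ∂μ : ℝ) * y ^ 2 / 2))) := by
  refine Complex.tendsto_pow_exp_of_isLittleO_sub_add_div _ ?_
  have h0 : Tendsto (fun N : ℕ => √(s / N) * y) atTop (𝓝 0) := by
    have := ((tendsto_const_div_atTop_nhds_zero_nat s).sqrt).mul_const y
    simpa using this
  have h := (charFun_sub_isLittleO_sq hint hmean).comp_tendsto h0
  have hsq (N : ℕ) : (√(s / N) * y) ^ 2 = s * y ^ 2 * (1 / N) := by
    rw [mul_pow, Real.sq_sqrt (by positivity)]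
    ring
  have h' : (fun N : ℕ => charFun μ (√(s / N) * y) - (1 + -s * (∫ x, x ^ 2 ∂μ : ℝ) * y ^ 2 / 2 / N))
      =o[atTop] fun N : ℕ => s * y ^ 2 * (1 / N : ℝ) := by
    convert! h using 2 with N N
    · have := hsq N
      have e : ((√(s / N) * y : ℝ) : ℂ) ^ 2 = s * y ^ 2 * (1 / N) := by
        rw [← Complex.ofReal_pow, this]
        push_cast
        ring
      simp only [Function.comp_apply, e]
      ring
    · exact (hsq N).symm
  rw [← Asymptotics.isLittleO_norm_right]
  have h2 := (h'.of_const_mul_right).norm_right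
  simpa using h2

lemma norm_charFun_lt_one {μ : Measure ℝ} [IsProbabilityMeasure μ]
    (hlim : Tendsto (charFun μ) (cocompact ℝ) (𝓝 0)) {t : ℝ} (ht : t ≠ 0) :
    ‖charFun μ t‖ < 1 := by
  have hn (x : ℝ) : ‖Complex.exp (t * x * Complex.I)‖ ≤ 1 := by
    rw [Complex.norm_exp]
    simp
  rcases ae_eq_const_or_norm_integral_lt_of_norm_le_const (ae_of_all μ hn) with h | h
  · exfalso
    set c := ⨍ x, Complex.exp (t * x * Complex.I) ∂μ
    have hc : ‖c‖ = 1 := by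
      obtain ⟨x, hx⟩ := h.exists
      rw [Function.const_apply] at hx
      rw [← hx, Complex.norm_exp]
      simp
    have hpow (n : ℕ) : charFun μ (n * t) = c ^ n := by
      rw [charFun_apply_real]
      have : (fun x : ℝ => Complex.exp ((n * t : ℝ) * x * Complex.I)) =ᵐ[μ] fun _ => c ^ n := by
        filter_upwards [h] with x hx
        rw [Function.const_apply] at hx
        rw [← hx, ← Complex.exp_nat_mul]
        push_cast
        ring_nf
      rw [integral_congr_ae this]
      simp
    have htend : Tendsto (fun n : ℕ => (n : ℝ) * t) atTop (cocompact ℝ) := by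
      rw [← Metric.cobounded_eq_cocompact, ← comap_norm_atTop, tendsto_comap_iff, Function.comp_def]
      simp only [norm_mul, RCLike.norm_natCast]
      exact tendsto_natCast_atTop_atTop.atTop_mul_const (norm_pos_iff.2 ht)
    have := (hlim.comp htend).norm
    simp [hpow, hc] at this
  · simpa [charFun_apply_real] using h

lemma one_sub_le_rpow_neg {u p : ℝ} (hu : 0 ≤ u) (hp : 0 ≤ p) : 1 - p * u ≤ (1 + u) ^ (-p) := by
  rw [Real.rpow_def_of_pos (by linarith)]
  have h1 := Real.add_one_le_exp (Real.log (1 + u) * -p)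
  have h2 := mul_le_mul_of_nonneg_left (Real.log_le_sub_one_of_pos (x := 1 + u) (by linarith)) hp
  linarith

lemma mul_abs_rpow_neg_le {C α c t : ℝ} (hC : 0 < C) (hα : 0 < α) (hc : 0 ≤ c)
    (hcC : c ≤ (C ^ (2 / α))⁻¹ / 2) (ht : 2 * C ^ (2 / α) ≤ t ^ 2) :
    C * |t| ^ (-α) ≤ (1 + c * t ^ 2) ^ (-(α / 2)) := by
  have hD : 0 < C ^ (2 / α) := by positivity
  have hCD : C = ((C ^ (2 / α))⁻¹) ^ (-(α / 2)) := by
    rw [Real.rpow_neg (by positivity), ← Real.inv_rpow (by positivity), inv_inv,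
      ← Real.rpow_mul hC.le]
    field_simp
    simp
  have htα : |t| ^ (-α) = (t ^ 2) ^ (-(α / 2)) := by
    rw [← sq_abs, ← Real.rpow_natCast, ← Real.rpow_mul (abs_nonneg t)]
    congr 1
    push_cast
    ring
  generalize C ^ (2 / α) = D at *
  rw [htα, hCD, ← Real.mul_rpow (by positivity) (by positivity)]
  refine Real.rpow_le_rpow_of_nonpos (by positivity) ?_ (by linarith)
  have h1 : 1 ≤ D⁻¹ / 2 * t ^ 2 := by
    calc 1 = D⁻¹ / 2 * (2 * D) := by field_simp
      _ ≤ _ := by gcongr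
  have h2 : c * t ^ 2 ≤ D⁻¹ / 2 * t ^ 2 := by gcongr
  linarith

lemma exists_le_one_add_mul_sq_rpow {f : ℝ → ℝ} {γ C T α : ℝ} (hf : Continuous f)
    (hlt : ∀ t ≠ 0, f t < 1) (hγ : 0 < γ) (hnear : ∀ᶠ t in 𝓝 0, f t ≤ 1 - γ * t ^ 2)
    (hC : 0 < C) (hα : 0 < α) (hdecay : ∀ t, T < |t| → f t ≤ C * |t| ^ (-α)) :
    ∃ c > 0, ∀ t, f t ≤ (1 + c * t ^ 2) ^ (-(α / 2)) := by
  obtain ⟨δ, hδ, hnear⟩ := Metric.eventually_nhds_iff.1 hnear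
  obtain ⟨R, hR⟩ := (((eventually_gt_atTop T).and (eventually_ge_atTop δ)).and
    ((tendsto_pow_atTop two_ne_zero).eventually_ge_atTop (2 * C ^ (2 / α)))).exists
  obtain ⟨⟨hRT, hRδ⟩, hRC⟩ := hR
  have hR0 : 0 < R := hδ.trans_le hRδ
  obtain ⟨q, hq1, hq⟩ : ∃ q < 1, ∀ t, δ ≤ |t| → |t| ≤ R → f t ≤ q := by
    have hK : IsCompact (Set.Icc (-R) R ∩ {t | δ ≤ |t|}) :=
      isCompact_Icc.inter_right (isClosed_le continuous_const continuous_abs)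
    obtain ⟨t₀, ht₀, hmax⟩ := hK.exists_isMaxOn
      ⟨R, ⟨by constructor <;> linarith, by rwa [Set.mem_ofPred_eq, abs_of_pos hR0]⟩⟩ hf.continuousOn
    refine ⟨f t₀, hlt t₀ (abs_pos.1 (hδ.trans_le ht₀.2)), fun t h1 h2 => hmax ⟨?_, h1⟩⟩
    exact abs_le.1 h2
  set c := min (γ * 2 / α) (min ((1 - q) * 2 / (α * R ^ 2)) ((C ^ (2 / α))⁻¹ / 2))
  have hc : 0 < c := by
    have : 0 < 1 - q := by linarith
    positivity
  have hc1 : c ≤ γ * 2 / α := min_le_left _ _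
  have hc2 : c ≤ (1 - q) * 2 / (α * R ^ 2) := (min_le_right _ _).trans (min_le_left _ _)
  have hc3 : c ≤ (C ^ (2 / α))⁻¹ / 2 := (min_le_right _ _).trans (min_le_right _ _)
  rw [le_div_iff₀ (by positivity)] at hc1 hc2
  refine ⟨c, hc, fun t => ?_⟩
  have hbern := one_sub_le_rpow_neg (u := c * t ^ 2) (p := α / 2) (by positivity) (by positivity)
  rcases lt_or_ge |t| δ with h | h
  · refine (hnear (by simpa using h)).trans (le_trans ?_ hbern)
    nlinarith [sq_nonneg t]
  rcases le_or_gt |t| R with h' | h'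
  · refine (hq t h h').trans (le_trans ?_ hbern)
    have : t ^ 2 ≤ R ^ 2 := sq_le_sq' (abs_le.1 h').1 (abs_le.1 h').2
    have : c * α * t ^ 2 ≤ c * α * R ^ 2 := by gcongr
    nlinarith
  · refine (hdecay t (hRT.trans h')).trans (mul_abs_rpow_neg_le hC hα hc.le hc3 (hRC.trans ?_))
    rw [← sq_abs t]
    gcongr

lemma eventually_norm_charFun_le {μ : Measure ℝ} [IsProbabilityMeasure μ]
    (hint : MemLp id 2 μ) (hmean : ∫ x, x ∂μ = 0) (hvar : 0 < ∫ x, x ^ 2 ∂μ) :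
    ∀ᶠ t in 𝓝 0, ‖charFun μ t‖ ≤ 1 - (∫ x, x ^ 2 ∂μ) / 4 * t ^ 2 := by
  have h := (charFun_sub_isLittleO_sq hint hmean).bound (show 0 < (∫ x, x ^ 2 ∂μ) / 4 by positivity)
  set v := ∫ x, x ^ 2 ∂μ
  have hsmall : ∀ᶠ t : ℝ in 𝓝 0, v * t ^ 2 / 2 < 1 := by
    have : Tendsto (fun t : ℝ => v * t ^ 2 / 2) (𝓝 0) (𝓝 (v * 0 ^ 2 / 2)) :=
      Continuous.tendsto (by fun_prop) _
    exact this.eventually_lt_const (by simp)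
  filter_upwards [h, hsmall] with t h1 h2
  have h3 : ‖(1 - v * (t : ℂ) ^ 2 / 2 : ℂ)‖ = 1 - v * t ^ 2 / 2 := by
    rw [← abs_of_pos (sub_pos.2 h2), ← Real.norm_eq_abs, ← Complex.norm_real]
    push_cast
    rfl
  have h4 := norm_le_norm_sub_add (charFun μ t) (1 - v * (t : ℂ) ^ 2 / 2)
  rw [Real.norm_of_nonneg (sq_nonneg t)] at h1
  linarith

lemma one_add_mul_rpow_pow_le {c β y : ℝ} {σ N : ℕ} (hc : 0 ≤ c) (hβ : 0 ≤ β) (hσ : 1 ≤ σ)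
    (hN : σ ≤ N) :
    ((1 + c * (√(σ / N) * y) ^ 2) ^ (-β)) ^ N ≤ (1 + c * y ^ 2) ^ (-(β * σ)) := by
  have hσ0 : (0 : ℝ) < σ := by exact_mod_cast hσ
  have hN0 : (0 : ℝ) < N := by exact_mod_cast hσ.trans hN
  have hp : (1 : ℝ) ≤ N / σ := by
    rw [one_le_div hσ0]
    exact_mod_cast hN
  have hs : (0 : ℝ) ≤ c * (√(σ / N) * y) ^ 2 := by positivity
  have hb := one_add_mul_self_le_rpow_one_add (s := c * (√(σ / N) * y) ^ 2) (by linarith) hp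
  have e : (N / σ : ℝ) * (c * (√(σ / N) * y) ^ 2) = c * y ^ 2 := by
    rw [mul_pow, Real.sq_sqrt (by positivity)]
    field_simp
  rw [e] at hb
  have h := Real.rpow_le_rpow_of_nonpos (by positivity) hb
    (show -(β * σ) ≤ 0 by rw [neg_nonpos]; positivity)
  refine le_trans (le_of_eq ?_) h
  rw [← Real.rpow_natCast, ← Real.rpow_mul (by positivity), ← Real.rpow_mul (by positivity)]
  congr 1
  field_simp

lemma integrable_one_add_mul_sq_rpow {c r : ℝ} (hc : 0 < c) (hr : 1 < r) :
    Integrable fun y : ℝ => (1 + c * y ^ 2) ^ (-r / 2) := by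
  have h := (integrable_rpow_neg_one_add_norm_sq (E := ℝ) (μ := volume) (r := r)
    (by simpa using hr)).comp_mul_left' (Real.sqrt_ne_zero'.2 hc)
  simpa [mul_pow, Real.sq_sqrt hc.le] using h

theorem fourier_transforms_converge_in_L1
    (ρ : ℝ → ℝ) (γ : ℝ) (σ : ℕ) (hσ : 1 ≤ σ)
    (hInt : Integrable ρ)
    (hpos : ∀ᵐ x : ℝ, 0 ≤ ρ x)
    (hmass : ∫ x : ℝ, ρ x = 1)
    (hm1 : Integrable (fun x : ℝ => x * ρ x))
    (hmean : ∫ x : ℝ, x * ρ x = 0)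
    (hm2 : Integrable (fun x : ℝ => x ^ 2 * ρ x))
    (hγ : γ = ∫ x : ℝ, x ^ 2 * ρ x) (hγpos : 0 < γ)
    (α C T : ℝ) (hα : 1 / (σ : ℝ) < α) (hC : 0 < C) (hT : 0 < T)
    (hdecay : ∀ t : ℝ, T < |t| → ‖FT ρ t‖ ≤ C * |t| ^ (-α)) :
    Tendsto
      (fun N : ℕ => ∫ y : ℝ,
        ‖FT (nConv (fun u : ℝ => (Real.sqrt ((σ : ℝ) / N))⁻¹ *
            ρ ((Real.sqrt ((σ : ℝ) / N))⁻¹ * u)) N) y -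
          (Real.exp (-(σ : ℝ) * γ * y ^ 2 / 2) : ℂ)‖)
      atTop (𝓝 0) := by
  set μ : Measure ℝ := volume.withDensity fun x => ENNReal.ofReal (ρ x) with hμ
  have hσ0 : (0 : ℝ) < σ := by exact_mod_cast hσ
  have hα0 : 0 < α := lt_trans (by positivity) hα
  have hασ : 1 < α * σ := by rwa [div_lt_iff₀ hσ0] at hα
  have hprob : IsProbabilityMeasure μ := by
    refine ⟨?_⟩
    rw [hμ, withDensity_apply _ MeasurableSet.univ, Measure.restrict_univ,
      ← ofReal_integral_eq_lintegral_ofReal hInt hpos, hmass, ENNReal.ofReal_one]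
  have hmeanμ : ∫ x, x ∂μ = 0 := by
    rw [integral_withDensity_ofReal hInt hpos, ← hmean]
    simp_rw [smul_eq_mul, mul_comm]
  have hvarμ : ∫ x, x ^ 2 ∂μ = γ := by
    rw [integral_withDensity_ofReal hInt hpos, hγ]
    simp_rw [smul_eq_mul, mul_comm]
  have hint : MemLp id 2 μ := (memLp_two_iff_integrable_sq (by fun_prop)).2
    (.of_integral_ne_zero (by simpa [hvarμ] using hγpos.ne'))
  have hFT (t : ℝ) : FT ρ t = charFun μ (-t) := FT_eq_charFun hInt hpos t
  have hnorm (t : ℝ) : T < |t| → ‖charFun μ t‖ ≤ C * |t| ^ (-α) := by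
    simpa [hFT] using hdecay (-t)
  have hlim : Tendsto (charFun μ) (cocompact ℝ) (𝓝 0) := by
    have habs : Tendsto (fun t : ℝ => |t|) (cocompact ℝ) atTop := tendsto_norm_cocompact_atTop
    refine squeeze_zero_norm' ((habs.eventually_gt_atTop T).mono hnorm) ?_
    simpa using ((tendsto_rpow_neg_atTop hα0).comp habs).const_mul C
  obtain ⟨c, hc, hbound⟩ := exists_le_one_add_mul_sq_rpow (continuous_charFun (μ := μ)).norm
    (fun t ht => norm_charFun_lt_one hlim ht) (by rw [hvarμ]; positivity)
    (eventually_norm_charFun_le hint hmeanμ (hvarμ ▸ hγpos)) hC hα0 hnorm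
  have hΦ : ∀ N : ℕ, σ ≤ N → ∀ y : ℝ,
      FT (nConv (fun u : ℝ => (√((σ : ℝ) / N))⁻¹ * ρ ((√((σ : ℝ) / N))⁻¹ * u)) N) y =
        charFun μ (√((σ : ℝ) / N) * -y) ^ N := by
    intro N hN y
    have hN0 : 0 < N := hσ.trans hN
    have ha : 0 < (√((σ : ℝ) / N))⁻¹ := by positivity
    obtain ⟨n, rfl⟩ := Nat.exists_eq_succ_of_ne_zero hN0.ne'
    rw [Nat.succ_eq_add_one, FT_nConv ((hInt.comp_mul_left' ha.ne').const_mul _),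
      FT_mul_comp_mul ρ ha, hFT, inv_inv, mul_neg]
  rw [← integral_zero ℝ ℝ]
  refine tendsto_integral_filter_of_dominated_convergence
    (fun y => (1 + c * y ^ 2) ^ (-(α * σ) / 2) + Real.exp (-(σ * γ / 2) * y ^ 2)) ?_ ?_
    ((integrable_one_add_mul_sq_rpow hc hασ).add (integrable_exp_neg_mul_sq (by positivity))) ?_
  · filter_upwards [eventually_ge_atTop σ] with N hN
    simp_rw [hΦ N hN]
    have := continuous_charFun (μ := μ)
    exact Continuous.aestronglyMeasurable (by fun_prop)
  · filter_upwards [eventually_ge_atTop σ] with N hN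
    refine ae_of_all _ fun y => ?_
    rw [hΦ N hN, norm_norm]
    refine (norm_sub_le _ _).trans (add_le_add ?_ (le_of_eq ?_))
    · rw [norm_pow]
      refine (pow_le_pow_left₀ (norm_nonneg _) (hbound _) N).trans
        ((one_add_mul_rpow_pow_le hc.le (by positivity) hσ hN).trans (le_of_eq ?_))
      rw [neg_sq]
      congr 1
      ring
    · rw [Complex.norm_real, Real.norm_of_nonneg (Real.exp_nonneg _)]
      congr 1
      ring
  · refine ae_of_all _ fun y => ?_
    have h := tendsto_charFun_pow hint hmeanμ σ (-y) hσ0.le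
    have h' := (h.sub_const ((Real.exp (-(σ : ℝ) * γ * y ^ 2 / 2) : ℝ) : ℂ)).norm
    rw [hvarμ] at h'
    push_cast [neg_sq] at h'
    rw [sub_self, norm_zero] at h'
    refine h'.congr' ?_
    filter_upwards [eventually_ge_atTop σ] with N hN
    rw [hΦ N hN]
    push_cast
    rfl
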